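/- For every s > 0 and every N > 2s, the limit J_N(s) := lim_{ε→0⁺} ∫_{‖ξ‖≤N} (‖ξ‖² + 2 s ξ₁ − iε)⁻¹ dξ exists (the integrand being Lebesgue integrable on the disc for each ε > 0), and there exist constants C > 0 and N₀ > 2s such that for all N ≥ N₀: |J_N(s) − 2π ln N − iπ² + 2π ln s| ≤ C/N. In other words, J_N(s) = 2π ln N + iπ² − 2π ln s + O(N⁻¹) as N → ∞. -/

import Mathlib

open MeasureTheory Real Filter Topology

lemma fad_norm_le (q ε : ℝ) (hq : 0 < q) : ‖((q : ℂ) - Complex.I * (ε : ℂ))⁻¹‖ ≤ q⁻¹ := by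
  rw [norm_inv]
  apply inv_anti₀ hq
  have := Complex.abs_re_le_norm ((q : ℂ) - Complex.I * (ε : ℂ))
  simp at this
  exact (le_abs_self q).trans this

lemma fad_norm_le' (q ε : ℝ) (hq : 0 < ε) : ‖((q : ℂ) - Complex.I * (ε : ℂ))⁻¹‖ ≤ ε⁻¹ := by
  rw [norm_inv]
  apply inv_anti₀ hq
  have := Complex.abs_im_le_norm ((q : ℂ) - Complex.I * (ε : ℂ))
  simp at this
  exact (le_abs_self ε).trans this

lemma fad_ne (q ε : ℝ) (hε : 0 < ε) : (q : ℂ) - Complex.I * (ε : ℂ) ∈ Complex.slitPlane := by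
  right; simp; exact hε.ne'

lemma fad_sq (s : ℝ) (ξ : EuclideanSpace ℝ (Fin 2)) :
    ‖ξ‖ ^ 2 + 2 * s * ξ 0 = ‖ξ + EuclideanSpace.single 0 s‖ ^ 2 - s ^ 2 := by
  rw [EuclideanSpace.norm_sq_eq, EuclideanSpace.norm_sq_eq]
  simp [Fin.sum_univ_two]
  ring

lemma fad_ftc (s R ε : ℝ) (hε : 0 < ε) :
    ∫ y in (0:ℝ)..R, (y : ℂ) * (((y ^ 2 - s ^ 2 : ℝ) : ℂ) - Complex.I * (ε : ℂ))⁻¹ =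
      (Complex.log (((R ^ 2 - s ^ 2 : ℝ) : ℂ) - Complex.I * (ε : ℂ))
        - Complex.log (((-s ^ 2 : ℝ) : ℂ) - Complex.I * (ε : ℂ))) / 2 := by
  have key : ∀ y : ℝ, HasDerivAt
      (fun y : ℝ => Complex.log (((y ^ 2 - s ^ 2 : ℝ) : ℂ) - Complex.I * (ε : ℂ)) / 2)
      ((y : ℂ) * (((y ^ 2 - s ^ 2 : ℝ) : ℂ) - Complex.I * (ε : ℂ))⁻¹) y := by
    intro y
    have h1 : HasDerivAt (fun y : ℝ => y ^ 2 - s ^ 2) (2 * y) y := by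
      simpa using (hasDerivAt_pow 2 y).sub_const (s ^ 2)
    have h2 := (h1.ofReal_comp.sub_const (Complex.I * (ε : ℂ))).clog_real (fad_ne _ ε hε)
    refine (h2.div_const 2).congr_deriv ?_
    push_cast
    ring
  rw [intervalIntegral.integral_eq_sub_of_hasDerivAt (fun y _ => key y)]
  · simp; ring
  · apply Continuous.intervalIntegrable
    apply Continuous.mul (by fun_prop)
    apply Continuous.inv₀ (by fun_prop)
    intro y
    exact Complex.slitPlane_ne_zero (fad_ne _ ε hε)

lemma fad_radial (s R ε : ℝ) (hR : 0 ≤ R) (hε : 0 < ε) :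
    ∫ ξ in Metric.closedBall (-EuclideanSpace.single 0 s : EuclideanSpace ℝ (Fin 2)) R,
      (((‖ξ‖ ^ 2 + 2 * s * ξ 0 : ℝ) : ℂ) - Complex.I * (ε : ℂ))⁻¹ =
    π * (Complex.log (((R ^ 2 - s ^ 2 : ℝ) : ℂ) - Complex.I * (ε : ℂ))
        - Complex.log (((-s ^ 2 : ℝ) : ℂ) - Complex.I * (ε : ℂ))) := by
  set g : ℝ → ℂ := (Set.Iic R).indicator
    (fun y => (((y ^ 2 - s ^ 2 : ℝ) : ℂ) - Complex.I * (ε : ℂ))⁻¹) with hg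
  rw [← integral_indicator Metric.isClosed_closedBall.measurableSet]
  have h1 : ((Metric.closedBall (-EuclideanSpace.single 0 s : EuclideanSpace ℝ (Fin 2)) R).indicator
      fun ξ => (((‖ξ‖ ^ 2 + 2 * s * ξ 0 : ℝ) : ℂ) - Complex.I * (ε : ℂ))⁻¹)
      = fun ξ => g ‖ξ + EuclideanSpace.single 0 s‖ := by
    ext ξ
    simp only [hg, Set.indicator, Metric.mem_closedBall, dist_eq_norm, sub_neg_eq_add, Set.mem_Iic,
      fad_sq]
  rw [h1, integral_add_right_eq_self (μ := volume)
    (fun ξ : EuclideanSpace ℝ (Fin 2) => g ‖ξ‖) (EuclideanSpace.single 0 s),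
    integral_fun_norm_addHaar]
  have h2 : ∫ y in Set.Ioi (0:ℝ), y ^ (Module.finrank ℝ (EuclideanSpace ℝ (Fin 2)) - 1) • g y
      = ∫ y in (0:ℝ)..R, (y : ℂ) * (((y ^ 2 - s ^ 2 : ℝ) : ℂ) - Complex.I * (ε : ℂ))⁻¹ := by
    rw [intervalIntegral.integral_of_le hR, ← Set.Ioi_inter_Iic,
      ← setIntegral_indicator measurableSet_Iic]
    congr 1
    ext y
    simp [hg, Set.indicator]
  rw [h2, fad_ftc s R ε hε]
  simp [Measure.real, EuclideanSpace.volume_ball_fin_two, ENNReal.toReal_ofReal Real.pi_pos.le]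
  ring

lemma fad_log_lim (s R : ℝ) (hs : 0 < s) (hR : s < R) :
    Tendsto (fun ε : ℝ => π * (Complex.log (((R ^ 2 - s ^ 2 : ℝ) : ℂ) - Complex.I * (ε : ℂ))
        - Complex.log (((-s ^ 2 : ℝ) : ℂ) - Complex.I * (ε : ℂ)))) (𝓝[>] 0)
      (𝓝 (π * (Real.log (R ^ 2 - s ^ 2) - (2 * Real.log s - π * Complex.I)))) := by
  have hq : 0 < R ^ 2 - s ^ 2 := by nlinarith
  refine Tendsto.const_mul _ (Tendsto.sub ?_ ?_)
  · have h : ContinuousAt (fun ε : ℝ => Complex.log (((R ^ 2 - s ^ 2 : ℝ) : ℂ) - Complex.I * (ε : ℂ))) 0 := by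
      apply ContinuousAt.clog (by fun_prop)
      left; simp only [Complex.ofReal_zero, mul_zero, sub_zero, Complex.ofReal_re]; exact hq
    have h2 := h.tendsto
    simp only [Complex.ofReal_zero, mul_zero, sub_zero, ← Complex.ofReal_log hq.le] at h2
    exact h2.mono_left nhdsWithin_le_nhds
  · have h := Complex.tendsto_log_nhdsWithin_im_neg_of_re_neg_of_im_zero
      (z := ((-s ^ 2 : ℝ) : ℂ)) (by simp only [Complex.ofReal_re]; nlinarith [pow_pos hs 2]) (by simp only [Complex.ofReal_im])
    have e : Real.log ‖((-s ^ 2 : ℝ) : ℂ)‖ = 2 * Real.log s := by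
      simp [Real.log_pow]
    rw [e] at h
    push_cast at h ⊢
    refine h.comp ?_
    rw [tendsto_nhdsWithin_iff]
    constructor
    · have : Continuous (fun ε : ℝ => -(s : ℂ) ^ 2 - Complex.I * (ε : ℂ)) := by fun_prop
      have := this.tendsto 0
      simp only [Complex.ofReal_zero, mul_zero, sub_zero] at this
      exact this.mono_left nhdsWithin_le_nhds
    · filter_upwards [self_mem_nhdsWithin] with ε hε
      have : (0:ℝ) < ε := hε
      simp [← Complex.ofReal_pow, this]

lemma fad_log_bd (s N : ℝ) (hs : 0 < s) (hN : 4 * s ≤ N) :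
    |Real.log ((N - s) ^ 2 - s ^ 2) - 2 * Real.log N| ≤ 4 * s / N := by
  have hN0 : 0 < N := by linarith
  have h0 : 0 < N - 2 * s := by linarith
  have e : (N - s) ^ 2 - s ^ 2 = N * (N - 2 * s) := by ring
  rw [e, Real.log_mul hN0.ne' h0.ne']
  have h1 : Real.log (N - 2 * s) ≤ Real.log N := Real.log_le_log h0 (by linarith)
  have h2 : Real.log N - Real.log (N - 2 * s) ≤ 4 * s / N := by
    rw [← Real.log_div hN0.ne' h0.ne']
    have := Real.log_le_sub_one_of_pos (div_pos hN0 h0)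
    refine this.trans ?_
    rw [div_sub_one h0.ne', div_le_div_iff₀ h0 hN0]
    nlinarith
  rw [abs_le]; constructor <;> linarith

lemma fad_int (s N ε : ℝ) (hε : 0 < ε) :
          IntegrableOn
            (fun ξ : EuclideanSpace ℝ (Fin 2) =>
              (((‖ξ‖ ^ 2 + 2 * s * ξ 0 : ℝ) : ℂ) - Complex.I * (ε : ℂ))⁻¹)
            (Metric.closedBall 0 N) := by
  apply ContinuousOn.integrableOn_compact (isCompact_closedBall _ _)
  apply Continuous.continuousOn
  apply Continuous.inv₀ (by fun_prop)
  intro y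
  exact Complex.slitPlane_ne_zero (fad_ne _ ε hε)

lemma fad_vol (c : EuclideanSpace ℝ (Fin 2)) (R : ℝ) (hR : 0 ≤ R) :
    volume.real (Metric.closedBall c R) = π * R ^ 2 := by
  simp [Measure.real, EuclideanSpace.volume_closedBall_fin_two, ENNReal.toReal_ofReal Real.pi_pos.le, hR]
  ring

theorem faddeev_green_symbol_real_momentum_asymptotics (s : ℝ) (hs : 0 < s) :
    ∃ J : ℝ → ℂ,
      (∀ N : ℝ, 2 * s < N →
        (∀ ε : ℝ, 0 < ε →
          IntegrableOn
            (fun ξ : EuclideanSpace ℝ (Fin 2) =>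
              (((‖ξ‖ ^ 2 + 2 * s * ξ 0 : ℝ) : ℂ) - Complex.I * (ε : ℂ))⁻¹)
            (Metric.closedBall 0 N)) ∧
        Tendsto
          (fun ε : ℝ =>
            ∫ ξ in Metric.closedBall (0 : EuclideanSpace ℝ (Fin 2)) N,
              (((‖ξ‖ ^ 2 + 2 * s * ξ 0 : ℝ) : ℂ) - Complex.I * (ε : ℂ))⁻¹)
          (𝓝[>] 0) (𝓝 (J N))) ∧
      ∃ C > (0:ℝ), ∃ N₀ > 2 * s, ∀ N ≥ N₀,
        ‖J N - (2 * Real.pi * Real.log N + Complex.I * Real.pi ^ 2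
            - 2 * Real.pi * Real.log s)‖ ≤ C / N := by
  set k : EuclideanSpace ℝ (Fin 2) := EuclideanSpace.single 0 s with hk
  have hkn : ‖k‖ = s := by simp [hk, abs_of_pos hs]
  set A : ℝ → Set (EuclideanSpace ℝ (Fin 2)) := fun N => Metric.closedBall (-k) (N - s) with hA
  set B : ℝ → Set (EuclideanSpace ℝ (Fin 2)) := fun N => Metric.closedBall 0 N \ A N with hB
  have hAB : ∀ N, A N ⊆ Metric.closedBall 0 N := by
    intro N
    apply Metric.closedBall_subset_closedBall'
    simp [hkn]
  have hAm : ∀ N, MeasurableSet (A N) := fun N => Metric.isClosed_closedBall.measurableSet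
  have hBm : ∀ N, MeasurableSet (B N) := fun N =>
    Metric.isClosed_closedBall.measurableSet.diff (hAm N)
  have hBfin : ∀ N, volume (B N) < ⊤ := fun N =>
    (measure_mono Set.sdiff_subset).trans_lt measure_closedBall_lt_top
  have hBq : ∀ N, 2 * s < N → ∀ ξ ∈ B N, N * (N - 2 * s) ≤ ‖ξ‖ ^ 2 + 2 * s * ξ 0 := by
    intro N hN ξ hξ
    rw [fad_sq]
    have h := hξ.2
    simp only [hA, Metric.mem_closedBall, dist_eq_norm, sub_neg_eq_add, not_le] at h
    rw [← hk]
    nlinarith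
  refine ⟨fun N => π * (Real.log ((N - s) ^ 2 - s ^ 2) - (2 * Real.log s - π * Complex.I)) +
    ∫ ξ in B N, (((‖ξ‖ ^ 2 + 2 * s * ξ 0 : ℝ) : ℂ))⁻¹, ?_, ?_⟩
  · intro N hN
    have hpos : 0 < N * (N - 2 * s) := mul_pos (by linarith) (by linarith)
    refine ⟨fun ε hε => fad_int s N ε hε, ?_⟩
    have hsplit : (fun ε : ℝ => π * (Complex.log ((((N - s) ^ 2 - s ^ 2 : ℝ) : ℂ) - Complex.I * (ε : ℂ))
        - Complex.log (((-s ^ 2 : ℝ) : ℂ) - Complex.I * (ε : ℂ))) +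
        ∫ ξ in B N, (((‖ξ‖ ^ 2 + 2 * s * ξ 0 : ℝ) : ℂ) - Complex.I * (ε : ℂ))⁻¹) =ᶠ[𝓝[>] 0]
        (fun ε : ℝ =>
            ∫ ξ in Metric.closedBall (0 : EuclideanSpace ℝ (Fin 2)) N,
              (((‖ξ‖ ^ 2 + 2 * s * ξ 0 : ℝ) : ℂ) - Complex.I * (ε : ℂ))⁻¹) := by
      filter_upwards [self_mem_nhdsWithin] with ε hε
      have hε : 0 < ε := hε
      rw [← fad_radial s (N - s) ε (by linarith) hε, setIntegral_sdiff (hAm N) (fad_int s N ε hε) (hAB N)]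
      simp [hA, hk]
    refine Tendsto.congr' hsplit (Tendsto.add (fad_log_lim s (N - s) hs (by linarith)) ?_)
    apply tendsto_integral_filter_of_dominated_convergence (fun _ => (N * (N - 2 * s))⁻¹)
    · filter_upwards [self_mem_nhdsWithin] with ε hε
      exact ((fad_int s N ε hε).mono_set Set.sdiff_subset).aestronglyMeasurable
    · filter_upwards [self_mem_nhdsWithin] with ε hε
      filter_upwards [ae_restrict_mem (hBm N)] with ξ hξ
      have := hBq N hN ξ hξ
      exact (fad_norm_le _ ε (hpos.trans_le this)).trans (inv_anti₀ hpos this)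
    · exact integrableOn_const (hBfin N).ne
    · filter_upwards [ae_restrict_mem (hBm N)] with ξ hξ
      have := hpos.trans_le (hBq N hN ξ hξ)
      set q := ‖ξ‖ ^ 2 + 2 * s * ξ 0
      have h : ContinuousAt (fun ε : ℝ => ((q : ℂ) - Complex.I * (ε : ℂ))⁻¹) 0 := by
        apply ContinuousAt.inv₀ (by fun_prop)
        simp [this.ne']
      have h2 := h.tendsto
      simp only [Complex.ofReal_zero, mul_zero, sub_zero] at h2
      exact h2.mono_left nhdsWithin_le_nhds
  · refine ⟨8 * π * s, by positivity, 4 * s, by linarith, fun N hN => ?_⟩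
    have hN0 : 0 < N := by linarith
    have h0 : 0 < N - 2 * s := by linarith
    have hpos : 0 < N * (N - 2 * s) := mul_pos hN0 h0
    have hb : ‖∫ ξ in B N, (((‖ξ‖ ^ 2 + 2 * s * ξ 0 : ℝ) : ℂ))⁻¹‖ ≤ 4 * π * s / N := by
      have h1 := norm_setIntegral_le_of_norm_le_const (μ := volume) (s := B N)
        (f := fun ξ => (((‖ξ‖ ^ 2 + 2 * s * ξ 0 : ℝ) : ℂ))⁻¹) (C := (N * (N - 2 * s))⁻¹)
        (hBfin N) (fun ξ hξ => by
          have h := hBq N (by linarith) ξ hξ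
          have h' := fad_norm_le _ 0 (hpos.trans_le h)
          simp only [Complex.ofReal_zero, mul_zero, sub_zero] at h'
          exact h'.trans (inv_anti₀ hpos h))
      refine h1.trans ?_
      have hv : volume.real (B N) = π * N ^ 2 - π * (N - s) ^ 2 := by
        simp only [hB]
        rw [measureReal_sdiff (hAB N) (hAm N) measure_closedBall_lt_top.ne,
          fad_vol _ _ hN0.le, fad_vol _ _ (by linarith)]
      rw [hv, inv_mul_eq_div, div_le_div_iff₀ hpos hN0]
      have : (π * N ^ 2 - π * (N - s) ^ 2) ≤ 2 * π * s * N := by nlinarith [Real.pi_pos, mul_pos Real.pi_pos (pow_pos hs 2)]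
      have h3 : 2 * π * s * N * N ≤ 4 * π * s * (N * (N - 2 * s)) := by
        have : 0 ≤ 2 * π * s * N * (N - 4 * s) := mul_nonneg (by positivity) (by linarith)
        linarith
      nlinarith
    have e : (π * (Real.log ((N - s) ^ 2 - s ^ 2) - (2 * Real.log s - π * Complex.I)) +
        ∫ ξ in B N, (((‖ξ‖ ^ 2 + 2 * s * ξ 0 : ℝ) : ℂ))⁻¹) -
        (2 * Real.pi * Real.log N + Complex.I * Real.pi ^ 2 - 2 * Real.pi * Real.log s)
        = ((π * (Real.log ((N - s) ^ 2 - s ^ 2) - 2 * Real.log N) : ℝ) : ℂ) +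
          ∫ ξ in B N, (((‖ξ‖ ^ 2 + 2 * s * ξ 0 : ℝ) : ℂ))⁻¹ := by
      push_cast
      ring
    show ‖(π * (Real.log ((N - s) ^ 2 - s ^ 2) - (2 * Real.log s - π * Complex.I)) +
        ∫ ξ in B N, (((‖ξ‖ ^ 2 + 2 * s * ξ 0 : ℝ) : ℂ))⁻¹) -
        (2 * Real.pi * Real.log N + Complex.I * Real.pi ^ 2 - 2 * Real.pi * Real.log s)‖ ≤ _
    rw [e]
    refine (norm_add_le _ _).trans ?_
    have h1 := mul_le_mul_of_nonneg_left (fad_log_bd s N hs hN) Real.pi_pos.le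
    have h2 : ‖((π * (Real.log ((N - s) ^ 2 - s ^ 2) - 2 * Real.log N) : ℝ) : ℂ)‖ ≤ π * (4 * s / N) := by
      rw [Complex.norm_real, Real.norm_eq_abs, abs_mul, abs_of_pos Real.pi_pos]
      exact h1
    calc _ ≤ π * (4 * s / N) + 4 * π * s / N := add_le_add h2 hb
      _ = 8 * π * s / N := by ring
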